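/- Let (h,u) be a C² smooth solution of the radially symmetric isentropic Euler equations in sound-speed form on an open set contained in {r > 0}, with h > 0 and c₁ c₂ ≠ 0 everywhere on that set. Then α satisfies the simplified Riccati equation ∂₂ α = −((γ+1)/4) α² + ((γ−3)/4) α β + A₂ (β − α) + ((γ−3) m / r) (u² h² / (c₂² c₁)) α, where A₂ = (m c₁/(2 r c₂²)) ((γ−1)/2 · u² − h²). -/

import Mathlib

open Real Set

/-- Partial derivative with respect to the spatial variable `r` (first coordinate). -/
noncomputable def pdr (f : ℝ × ℝ → ℝ) (p : ℝ × ℝ) : ℝ := fderiv ℝ f p (1, 0)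

/-- Partial derivative with respect to the time variable `t` (second coordinate). -/
noncomputable def pdt (f : ℝ × ℝ → ℝ) (p : ℝ × ℝ) : ℝ := fderiv ℝ f p (0, 1)

/-- Directional derivative `∂_t + c ∂_r` along a characteristic with speed `c`. -/
noncomputable def Dc (c f : ℝ × ℝ → ℝ) (p : ℝ × ℝ) : ℝ := pdt f p + c p * pdr f p

/-- `(h,u)` solves the radially symmetric isentropic Euler equations in
sound-speed form on the set `U`. -/
def IsEulerSound (γ : ℝ) (m : ℕ) (U : Set (ℝ × ℝ)) (h u : ℝ × ℝ → ℝ) : Prop :=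
  ∀ p ∈ U,
    pdt h p + u p * pdr h p + (γ - 1) / 2 * h p * pdr u p
      = -((γ - 1) / 2) * ((m : ℝ) * u p * h p / p.1) ∧
    pdt u p + u p * pdr u p + 2 / (γ - 1) * h p * pdr h p = 0

/-- The gradient variable `α = u_r + (2/(γ-1)) h_r + m h u / (r c₂)`. -/
noncomputable def alp (γ : ℝ) (m : ℕ) (h u : ℝ × ℝ → ℝ) (p : ℝ × ℝ) : ℝ :=
  pdr u p + 2 / (γ - 1) * pdr h p + (m : ℝ) * h p * u p / (p.1 * (u p + h p))

/-- The gradient variable `β = u_r - (2/(γ-1)) h_r - m h u / (r c₁)`. -/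
noncomputable def bet (γ : ℝ) (m : ℕ) (h u : ℝ × ℝ → ℝ) (p : ℝ × ℝ) : ℝ :=
  pdr u p - 2 / (γ - 1) * pdr h p - (m : ℝ) * h p * u p / (p.1 * (u p - h p))

/-- The weighted gradient variable `α̃ = h^{(γ-3)/(2(γ-1))} α`. -/
noncomputable def alpT (γ : ℝ) (m : ℕ) (h u : ℝ × ℝ → ℝ) (p : ℝ × ℝ) : ℝ :=
  h p ^ ((γ - 3) / (2 * (γ - 1))) * alp γ m h u p

/-- The weighted gradient variable `β̃ = h^{(γ-3)/(2(γ-1))} β`. -/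
noncomputable def betT (γ : ℝ) (m : ℕ) (h u : ℝ × ℝ → ℝ) (p : ℝ × ℝ) : ℝ :=
  h p ^ ((γ - 3) / (2 * (γ - 1))) * bet γ m h u p

lemma aux_line {f : ℝ × ℝ → ℝ} {p : ℝ × ℝ} (hf : DifferentiableAt ℝ f p) (v : ℝ × ℝ) :
    HasDerivAt (fun t : ℝ => f (p + t • v)) (fderiv ℝ f p v) 0 :=
  hf.hasFDerivAt.hasLineDerivAt v

lemma aux_diff {f : ℝ × ℝ → ℝ} {p : ℝ × ℝ} (hf : ContDiffAt ℝ 2 f p) (v : ℝ × ℝ) :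
    DifferentiableAt ℝ (fun q => fderiv ℝ f q v) p := by
  have h1 : ContDiffAt ℝ 1 (fderiv ℝ f) p := hf.fderiv_right (by norm_num)
  exact (h1.differentiableAt (by norm_num)).clm_apply (differentiableAt_const v)

lemma aux_symm {f : ℝ × ℝ → ℝ} {p : ℝ × ℝ} (hf : ContDiffAt ℝ 2 f p) (v w : ℝ × ℝ) :
    fderiv ℝ (fun q => fderiv ℝ f q v) p w = fderiv ℝ (fun q => fderiv ℝ f q w) p v := by
  have h1 : ContDiffAt ℝ 1 (fderiv ℝ f) p := hf.fderiv_right (by norm_num)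
  have h2 : DifferentiableAt ℝ (fderiv ℝ f) p := h1.differentiableAt (by norm_num)
  have h3 : IsSymmSndFDerivAt ℝ f p := hf.isSymmSndFDerivAt (by simp)
  have h4 := h3 v w
  rw [fderiv_clm_apply h2 (differentiableAt_const v),
    fderiv_clm_apply h2 (differentiableAt_const w)]
  simp [h4]

lemma aux_alp (γ : ℝ) (m : ℕ) (h u : ℝ × ℝ → ℝ) (p : ℝ × ℝ)
    (hr : p.1 ≠ 0) (hc : u p + h p ≠ 0) (hh : ContDiffAt ℝ 2 h p) (hu : ContDiffAt ℝ 2 u p)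
    (v : ℝ × ℝ) :
    fderiv ℝ (alp γ m h u) p v =
      fderiv ℝ (pdr u) p v + 2 / (γ - 1) * fderiv ℝ (pdr h) p v
      + (m * fderiv ℝ h p v * u p + m * h p * fderiv ℝ u p v) / (p.1 * (u p + h p))
      - m * h p * u p * (v.1 * (u p + h p) + p.1 * (fderiv ℝ u p v + fderiv ℝ h p v))
        / (p.1 * (u p + h p)) ^ 2 := by
  have dh : DifferentiableAt ℝ h p := hh.differentiableAt (by norm_num)
  have du : DifferentiableAt ℝ u p := hu.differentiableAt (by norm_num)
  have dhr : DifferentiableAt ℝ (pdr h) p := aux_diff hh (1, 0)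
  have dur : DifferentiableAt ℝ (pdr u) p := aux_diff hu (1, 0)
  have hne : p.1 * (u p + h p) ≠ 0 := mul_ne_zero hr hc
  have d1 : DifferentiableAt ℝ (fun q : ℝ × ℝ => q.1) p := differentiableAt_fst
  have l1 : HasDerivAt (fun t : ℝ => (p + t • v).1) v.1 0 := by
    have := aux_line d1 v
    simpa [fderiv_fst] using this
  have da : DifferentiableAt ℝ (alp γ m h u) p := by
    unfold alp
    have n1 : DifferentiableAt ℝ (fun q : ℝ × ℝ => (m : ℝ) * h q * u q) p :=
      (dh.const_mul _).mul du
    have n2 : DifferentiableAt ℝ (fun q : ℝ × ℝ => q.1 * (u q + h q)) p :=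
      d1.mul (du.add dh)
    have n3 : DifferentiableAt ℝ (fun q : ℝ × ℝ => (m : ℝ) * h q * u q / (q.1 * (u q + h q))) p := by
      simp only [div_eq_mul_inv]
      exact n1.mul (n2.fun_inv hne)
    exact (dur.add (dhr.const_mul _)).add n3
  have e := ((aux_line dur v).add ((aux_line dhr v).const_mul (2 / (γ - 1)))).add
      ((((aux_line dh v).const_mul (m : ℝ)).mul (aux_line du v)).div
        (l1.mul ((aux_line du v).add (aux_line dh v))) (by simpa using hne))
  rw [(aux_line da v).unique e]
  simp only [Pi.mul_apply, Pi.add_apply, zero_smul, add_zero]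
  field_simp
  ring

lemma aux_alg (γ m r h u hr ur ht ut hrr urr hrt urt : ℝ) (hγ : γ - 1 ≠ 0) (r0 : r ≠ 0)
    (c1 : u - h ≠ 0) (c2 : u + h ≠ 0)
    (e1 : ht = -u * hr - (γ - 1) / 2 * h * ur - (γ - 1) / 2 * (m * u * h / r))
    (e2 : ut = -u * ur - 2 / (γ - 1) * h * hr)
    (e3 : hrt = -ur * hr - u * hrr - (γ - 1) / 2 * (hr * ur + h * urr)
      - (γ - 1) / 2 * (m * (ur * h + u * hr) / r - m * u * h / r ^ 2))
    (e4 : urt = -ur ^ 2 - u * urr - 2 / (γ - 1) * (hr ^ 2 + h * hrr))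
    (a b : ℝ) (ha : a = ur + 2 / (γ - 1) * hr + m * h * u / (r * (u + h)))
    (hb : b = ur - 2 / (γ - 1) * hr - m * h * u / (r * (u - h))) :
    (urt + 2 / (γ - 1) * hrt + (m * ht * u + m * h * ut) / (r * (u + h))
      - m * h * u * (0 * (u + h) + r * (ut + ht)) / (r * (u + h)) ^ 2)
    + (u + h) * (urr + 2 / (γ - 1) * hrr + (m * hr * u + m * h * ur) / (r * (u + h))
      - m * h * u * (1 * (u + h) + r * (ur + hr)) / (r * (u + h)) ^ 2)
    = -((γ + 1) / 4) * a ^ 2 + (γ - 3) / 4 * (a * b)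
      + (m * (u - h) / (2 * r * (u + h) ^ 2) * ((γ - 1) / 2 * u ^ 2 - h ^ 2)) * (b - a)
      + (γ - 3) * m / r * (u ^ 2 * h ^ 2 / ((u + h) ^ 2 * (u - h))) * a := by
  subst e1 e2 e3 e4 ha hb
  field_simp
  ring

/-- simplified Riccati equation
`∂₂α = -((γ+1)/4)α² + ((γ-3)/4)αβ + A₂(β-α) + ((γ-3)m/r)(u²h²/(c₂²c₁))α`
for a `C²` smooth solution of the sound-speed Euler system. -/
theorem simplified_riccati_alpha
    (γ : ℝ) (hγ : 1 < γ) (m : ℕ) (hm : 1 ≤ m)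
    (U : Set (ℝ × ℝ)) (hU : IsOpen U) (hUr : ∀ p ∈ U, 0 < p.1)
    (h u : ℝ × ℝ → ℝ) (hhpos : ∀ p ∈ U, 0 < h p)
    (hc : ∀ p ∈ U, (u p - h p) * (u p + h p) ≠ 0)
    (hhC : ContDiffOn ℝ 2 h U) (huC : ContDiffOn ℝ 2 u U)
    (heuler : IsEulerSound γ m U h u) :
    ∀ p ∈ U,
      Dc (fun q => u q + h q) (alp γ m h u) p
        = -((γ + 1) / 4) * alp γ m h u p ^ 2
          + (γ - 3) / 4 * (alp γ m h u p * bet γ m h u p)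
          + ((m : ℝ) * (u p - h p) / (2 * p.1 * (u p + h p) ^ 2)
              * ((γ - 1) / 2 * u p ^ 2 - h p ^ 2))
            * (bet γ m h u p - alp γ m h u p)
          + (γ - 3) * (m : ℝ) / p.1
              * (u p ^ 2 * h p ^ 2 / ((u p + h p) ^ 2 * (u p - h p)))
            * alp γ m h u p := by
  intro p hp
  have hn : U ∈ nhds p := hU.mem_nhds hp
  have r0 : p.1 ≠ 0 := (hUr p hp).ne'
  have c1 := left_ne_zero_of_mul (hc p hp)
  have c2 := right_ne_zero_of_mul (hc p hp)
  have hh : ContDiffAt ℝ 2 h p := hhC.contDiffAt hn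
  have hu : ContDiffAt ℝ 2 u p := huC.contDiffAt hn
  have g0 : γ - 1 ≠ 0 := by linarith
  have dh : DifferentiableAt ℝ h p := hh.differentiableAt (by norm_num)
  have du : DifferentiableAt ℝ u p := hu.differentiableAt (by norm_num)
  have dhr : DifferentiableAt ℝ (pdr h) p := aux_diff hh (1, 0)
  have dur : DifferentiableAt ℝ (pdr u) p := aux_diff hu (1, 0)
  have d1 : DifferentiableAt ℝ (fun q : ℝ × ℝ => q.1) p := differentiableAt_fst
  have l1 : HasDerivAt (fun t : ℝ => (p + t • ((1 : ℝ), (0 : ℝ))).1) 1 0 := by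
    have := aux_line d1 (1, 0)
    simpa [fderiv_fst] using this
  have lh := aux_line dh (1, 0)
  have lu := aux_line du (1, 0)
  have lhr := aux_line dhr (1, 0)
  have lur := aux_line dur (1, 0)
  have key : ∀ f g : ℝ × ℝ → ℝ, (∀ q ∈ U, f q = g q) →
      (fun t : ℝ => f (p + t • ((1 : ℝ), (0 : ℝ)))) =ᶠ[nhds 0]
      (fun t : ℝ => g (p + t • ((1 : ℝ), (0 : ℝ)))) := by
    intro f g hfg
    have ct : ContinuousAt (fun t : ℝ => p + t • ((1 : ℝ), (0 : ℝ))) 0 := by fun_prop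
    have hm' : U ∈ nhds (p + (0 : ℝ) • ((1 : ℝ), (0 : ℝ))) := by simpa using hn
    filter_upwards [ct hm'] with t ht
    exact hfg _ ht
  have E1 : ∀ q ∈ U, pdt h q = -1 * (u q * pdr h q) - (γ - 1) / 2 * (h q * pdr u q)
      - (γ - 1) / 2 * ((m : ℝ) * (u q * h q) / q.1) := by
    intro q hq
    have := (heuler q hq).1
    rw [← mul_assoc (m : ℝ)]
    linarith
  have E2 : ∀ q ∈ U, pdt u q = -1 * (u q * pdr u q) - 2 / (γ - 1) * (h q * pdr h q) := by
    intro q hq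
    have := (heuler q hq).2
    linarith
  have S1 : fderiv ℝ (pdr h) p (0, 1) = fderiv ℝ (pdt h) p (1, 0) := aux_symm hh _ _
  have S2 : fderiv ℝ (pdr u) p (0, 1) = fderiv ℝ (pdt u) p (1, 0) := aux_symm hu _ _
  have dht : DifferentiableAt ℝ (pdt h) p := aux_diff hh (0, 1)
  have dut : DifferentiableAt ℝ (pdt u) p := aux_diff hu (0, 1)
  have F1 := ((aux_line dht (1, 0)).congr_of_eventuallyEq (key _ _ E1).symm).unique
    ((((lu.mul lhr).const_mul (-1)).sub ((lh.mul lur).const_mul ((γ - 1) / 2))).sub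
      ((((lu.mul lh).const_mul (m : ℝ)).div l1 (by simpa using r0)).const_mul ((γ - 1) / 2)))
  have F2 := ((aux_line dut (1, 0)).congr_of_eventuallyEq (key _ _ E2).symm).unique
    (((lu.mul lur).const_mul (-1)).sub ((lh.mul lhr).const_mul (2 / (γ - 1))))
  simp only [Pi.mul_apply, zero_smul, add_zero] at F1 F2
  have A := aux_alg γ m p.1 (h p) (u p) (pdr h p) (pdr u p) (pdt h p) (pdt u p)
    (fderiv ℝ (pdr h) p (1, 0)) (fderiv ℝ (pdr u) p (1, 0))
    (fderiv ℝ (pdr h) p (0, 1)) (fderiv ℝ (pdr u) p (0, 1)) g0 r0 c1 c2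
    (by rw [E1 p hp]; ring) (by rw [E2 p hp]; ring)
    (by rw [S1, F1]; simp only [pdr]; field_simp; ring)
    (by rw [S2, F2]; simp only [pdr]; ring)
    (alp γ m h u p) (bet γ m h u p) rfl rfl
  rw [← A]
  unfold Dc
  rw [show pdt (alp γ m h u) p = fderiv ℝ (alp γ m h u) p (0, 1) from rfl,
    show pdr (alp γ m h u) p = fderiv ℝ (alp γ m h u) p (1, 0) from rfl,
    aux_alp γ m h u p r0 c2 hh hu, aux_alp γ m h u p r0 c2 hh hu]
  rfl
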